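/- Let G be a countable group, Σ a nonempty finite alphabet, and Ω a relative system over G with alphabet Σ whose environment space Θ is a standard Borel space. Let ν be a probability measure on Θ. Let J : C_Θ(Ω) → ℝ be a positive linear functional (J(f) ≥ 0 whenever f ≥ 0 on Ω) that is ν-normalized, meaning J(1_{(A × Σ^G) ∩ Ω}) = ν(A) for every measurable A ⊆ Θ. Then there exists a unique probability measure μ on Ω such that ∫ f dμ = J(f) for every f ∈ C_Θ(Ω); moreover the pushforward of μ under (θ,x) ↦ θ equals ν. -/

import Mathlib

open MeasureTheory Filter Topology
open scoped Pointwise ENNReal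
noncomputable section

namespace DLR

variable (G : Type) [Group G] [Countable G] [DecidableEq G]
variable (S : Type) [Fintype S] [Nonempty S] [TopologicalSpace S] [DiscreteTopology S]
  [MeasurableSpace S] [MeasurableSingletonClass S]
variable (Θ : Type) [MeasurableSpace Θ]

/-- The translation action of `G` on configurations: `(g • x)_k = x_{g⁻¹ k}`. -/
def shift (g : G) (x : G → S) : G → S := fun k => x (g⁻¹ * k)

/-- A relative system over `G` with alphabet `S` and environment space `Θ`. -/
structure RelSystem where
  act : G → Θ → Θ
  act_one : ∀ θ, act 1 θ = θ
  act_mul : ∀ g h θ, act (g * h) θ = act g (act h θ)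
  act_measurable : ∀ g, Measurable (act g)
  X : Θ → Set (G → S)
  X_closed : ∀ θ, IsClosed (X θ)
  omega_measurable : MeasurableSet {p : Θ × (G → S) | p.2 ∈ X p.1}
  X_equivariant : ∀ g θ, X (act g θ) = (shift G S g) '' (X θ)

variable {G S Θ}

/-- The total space of a relative system, as a subset of `Θ × Σ^G`. -/
def RelSystem.Omega (R : RelSystem G S Θ) : Set (Θ × (G → S)) := {p | p.2 ∈ R.X p.1}

/-- The σ-algebra on `Θ × Σ^G` generated by the environment coordinate. -/
def FTheta : MeasurableSpace (Θ × (G → S)) := MeasurableSpace.comap Prod.fst inferInstance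

/-- The σ-algebra on `Θ × Σ^G` generated by the configuration restricted to `B ⊆ G`. -/
def xi (B : Set G) : MeasurableSpace (Θ × (G → S)) :=
  MeasurableSpace.comap (fun p => (fun b : B => p.2 b)) inferInstance

/-- The cylinder set of a pattern `u` with support a finite set `A ⊆ G`. -/
def cyl (A : Finset G) (u : A → S) : Set (Θ × (G → S)) := {p | ∀ a : A, p.2 a = u a}

/-- Merging a pattern `u` on `A` with a configuration `x` off `A`: `x_{G∖A} ∨ u`. -/
def mergePat (A : Finset G) (x : G → S) (u : A → S) : G → S :=
  fun k => if h : k ∈ A then u ⟨k, h⟩ else x k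

/-- A bounded relatively continuous observable (membership in `C_Θ(Ω)`). -/
def RelCont (R : RelSystem G S Θ) (f : Θ × (G → S) → ℝ) : Prop :=
  Measurable f ∧ (∃ c : ℝ, ∀ p ∈ R.Omega, |f p| ≤ c) ∧
    ∀ ε > 0, ∃ A : Finset G, ∀ θ : Θ, ∀ x ∈ R.X θ, ∀ y ∈ R.X θ,
      (∀ a ∈ A, x a = y a) → |f (θ, x) - f (θ, y)| < ε

variable (G S Θ) in
/-- A relative interaction on a relative system. -/
structure Interaction (R : RelSystem G S Θ) where
  Phi : Finset G → Θ × (G → S) → ℝ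
  measurable' : ∀ A : Finset G, Measurable[FTheta ⊔ xi (↑A : Set G)] (Phi A)
  bounded' : ∀ A : Finset G, ∃ c : ℝ, ∀ p, |Phi A p| ≤ c
  equivariant' : ∀ (g : G) (A : Finset G) (p : Θ × (G → S)),
    Phi (A.image (g * ·)) p = Phi A (R.act g⁻¹ p.1, shift G S g⁻¹ p.2)

variable {R : RelSystem G S Θ}

/-- The supremum norm of the `A`-component of an interaction. -/
def supAbs {α : Type} (f : α → ℝ) : ℝ := ⨆ p, |f p|

/-- Absolute summability of a relative interaction. -/
def Interaction.AbsSummable (Φ : Interaction G S Θ R) : Prop :=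
  Summable (fun A : Finset G => if (1 : G) ∈ A then supAbs (Φ.Phi A) else 0)

/-- The norm `‖Φ‖` of an absolutely summable interaction. -/
def Interaction.norm (Φ : Interaction G S Θ R) : ℝ :=
  ∑' A : Finset G, if (1 : G) ∈ A then supAbs (Φ.Phi A) else 0

/-- The energy `E_A = Σ_{C ⊆ A} Φ_C` of a finite region `A`. -/
def energy (Φ : Interaction G S Θ R) (A : Finset G) (p : Θ × (G → S)) : ℝ :=
  ∑ C ∈ A.powerset, Φ.Phi C p

/-- The conditional energy `E_{A|A^c} = Σ_{C ∩ A ≠ ∅} Φ_C`. -/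
def condEnergy (Φ : Interaction G S Θ R) (A : Finset G) (p : Θ × (G → S)) : ℝ :=
  ∑' C : Finset G, if (C ∩ A).Nonempty then Φ.Phi C p else 0

/-- The conditional energy `E_{A|B} = E_{A∪B} - E_B` for finite `A`, `B`. -/
def condEnergyFin (Φ : Interaction G S Θ R) (A B : Finset G) (p : Θ × (G → S)) : ℝ :=
  energy Φ (A ∪ B) p - energy Φ B p

open Classical in
/-- The partition function `Z_{A|A^c}(θ,x)`. -/
def partitionZ (Φ : Interaction G S Θ R) (A : Finset G) (p : Θ × (G → S)) : ℝ :=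
  ∑ u : A → S, if mergePat A p.2 u ∈ R.X p.1
    then Real.exp (-(condEnergy Φ A (p.1, mergePat A p.2 u))) else 0

open Classical in
/-- The Gibbs kernel `K_A((θ,x),·)` associated to an interaction. -/
def gibbsKernel (Φ : Interaction G S Θ R) (A : Finset G) (p : Θ × (G → S)) :
    Measure (Θ × (G → S)) :=
  ∑ u : A → S, if mergePat A p.2 u ∈ R.X p.1
    then (ENNReal.ofReal (Real.exp (-(condEnergy Φ A (p.1, mergePat A p.2 u))) /
            partitionZ Φ A p)) • Measure.dirac (p.1, mergePat A p.2 u)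
    else 0

/-- Conditional entropy `H_μ(ξ^A | m)` of the partition into `A`-cylinders given
a sub-σ-algebra `m`, defined via conditional expectation. -/
def condEntropy (μ : Measure (Θ × (G → S))) (A : Finset G)
    (m : MeasurableSpace (Θ × (G → S))) : ℝ :=
  ∫ p, (∑ u : A → S,
    Real.negMulLog ((μ[Set.indicator (cyl A u) (fun _ => (1:ℝ)) | m]) p)) ∂μ

/-- The conditional relative pressure `Ψ_μ(A | A^c)`. -/
def pressureCond (Φ : Interaction G S Θ R) (μ : Measure (Θ × (G → S))) (A : Finset G) : ℝ :=
  condEntropy μ A (xi ((↑A : Set G)ᶜ) ⊔ FTheta) - ∫ p, condEnergy Φ A p ∂μ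

/-- The conditional relative pressure `Ψ_μ(A | B)` for finite disjoint `A`, `B`. -/
def pressureCondFin (Φ : Interaction G S Θ R) (μ : Measure (Θ × (G → S)))
    (A B : Finset G) : ℝ :=
  condEntropy μ A (xi (↑B : Set G) ⊔ FTheta) - ∫ p, condEnergyFin Φ A B p ∂μ

/-- Weak topological Markov property relative to `Θ`. -/
def RelSystem.WeakTMP (R : RelSystem G S Θ) : Prop :=
  ∀ A : Finset G, ∃ B : Finset G, A ⊆ B ∧ ∀ θ : Θ, ∀ x ∈ R.X θ, ∀ x' ∈ R.X θ,
    (∀ g ∈ B \ A, x g = x' g) → (fun g => if g ∈ B then x g else x' g) ∈ R.X θ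

/-- A right Følner sequence in a countable group. -/
def RightFolner (F : ℕ → Finset G) : Prop :=
  (∀ n, (F n).Nonempty) ∧
  ∀ g : G, Tendsto (fun n => ((symmDiff (F n) ((F n).image (· * g))).card : ℝ) / (F n).card)
    atTop (𝓝 0)
section Separation

/-- A sequence of sets is jointly separable if it can be enlarged to a sequence of measurable sets
with empty intersection. -/
def JointlySeparable {α : Type*} [MeasurableSpace α] (s : ℕ → Set α) : Prop :=
  ∃ t : ℕ → Set α, (∀ n, MeasurableSet (t n)) ∧ (∀ n, s n ⊆ t n) ∧ ⋂ n, t n = ∅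

theorem JointlySeparable.of_update {α : Type*} [MeasurableSpace α] {s : ℕ → Set α} {i : ℕ}
    {P : ℕ → Set α} (hP : s i ⊆ ⋃ k, P k)
    (h : ∀ k, JointlySeparable (Function.update s i (P k))) : JointlySeparable s := by
  choose t ht hst hinter using h
  refine ⟨fun n => if n = i then ⋃ k, t k n else ⋂ k, t k n, fun n => ?_, fun n => ?_, ?_⟩
  · dsimp only
    split_ifs
    · exact MeasurableSet.iUnion fun k => ht k n
    · exact MeasurableSet.iInter fun k => ht k n
  · dsimp only
    split_ifs with hn
    · subst hn
      refine hP.trans (Set.iUnion_mono fun k => ?_)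
      simpa using hst k n
    · refine Set.subset_iInter fun k => ?_
      simpa [Function.update_of_ne hn] using hst k n
  · refine Set.eq_empty_of_forall_notMem fun x hx => ?_
    rw [Set.mem_iInter] at hx
    have hi := hx i
    rw [if_pos rfl, Set.mem_iUnion] at hi
    obtain ⟨k, hk⟩ := hi
    have : x ∈ ⋂ n, t k n := by
      refine Set.mem_iInter.2 fun n => ?_
      by_cases hn : n = i
      · rwa [hn]
      · have := hx n
        rw [if_neg hn] at this
        exact Set.mem_iInter.1 this k
    rw [hinter k] at this
    exact this

theorem exists_forall_of_extend {p : ℕ → (ℕ → ℕ) → Prop}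
    (hcongr : ∀ k y z, (∀ j < k, y j = z j) → p k y → p k z)
    (hzero : ∃ y, p 0 y)
    (hstep : ∀ k y, p k y → ∃ v, p (k + 1) (Function.update y k v)) :
    ∃ y, ∀ k, p k y := by
  obtain ⟨y₀, hy₀⟩ := hzero
  choose v hv using hstep
  let Y : (k : ℕ) → {y // p k y} := fun k =>
    Nat.rec ⟨y₀, hy₀⟩ (fun k y => ⟨Function.update y.1 k (v k y.1 y.2), hv k y.1 y.2⟩) k
  have hY : ∀ k, (Y (k + 1)).1 = Function.update (Y k).1 k (v k (Y k).1 (Y k).2) := fun k => rfl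
  have hstable : ∀ k j, j < k → (Y k).1 j = (Y (j + 1)).1 j := by
    intro k j hjk
    induction k, hjk using Nat.le_induction with
    | base => rfl
    | succ k hk ih =>
      rw [hY k, Function.update_of_ne (by omega), ih]
  exact ⟨fun j => (Y (j + 1)).1 j, fun k => hcongr k _ _ (hstable k) (Y k).2⟩

theorem jointlySeparable_range {α : Type*} [TopologicalSpace α] [T2Space α] [MeasurableSpace α]
    [OpensMeasurableSpace α] {f : ℕ → (ℕ → ℕ) → α} (hf : ∀ n, Continuous (f n))
    (h : ⋂ n, Set.range (f n) = ∅) : JointlySeparable fun n => Set.range (f n) := by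
  by_contra hsep
  let c : ℕ → (ℕ → ℕ) → ℕ → Set (ℕ → ℕ) := fun k y n =>
    {x | ∀ j, Nat.pair n j < k → x j = y (Nat.pair n j)}
  obtain ⟨y, hy⟩ := exists_forall_of_extend
    (p := fun k y => ¬ JointlySeparable fun n => f n '' c k y n) (by
      intro k y z hyz
      have : c k y = c k z := by
        ext n x
        exact forall_congr' fun j => forall_congr' fun hj => by rw [hyz _ hj]
      rw [this]
      exact id) (by
      refine ⟨0, ?_⟩
      simpa [c, Set.image_univ] using hsep) (by
      intro k y
      contrapose!
      intro H
      refine JointlySeparable.of_update (i := k.unpair.1)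
        (P := fun v => f k.unpair.1 '' c (k + 1) (Function.update y k v) k.unpair.1) ?_ fun v => ?_
      · rintro _ ⟨x, hx, rfl⟩
        refine Set.mem_iUnion.2 ⟨x k.unpair.2, x, fun j hj => ?_, rfl⟩
        by_cases hjk : Nat.pair k.unpair.1 j = k
        · have : j = k.unpair.2 := by
            rw [← hjk]
            simp
          rw [hjk, Function.update_self, this]
        · rw [Function.update_of_ne hjk]
          exact hx j (by omega)
      · convert H v using 1
        ext n : 1
        by_cases hn : n = k.unpair.1
        · subst hn
          simp
        · rw [Function.update_of_ne hn]
          congr 1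
          ext x
          refine forall_congr' fun j => ?_
          have hne : Nat.pair n j ≠ k := by
            rintro rfl
            simp at hn
          rw [Function.update_of_ne hne]
          exact imp_congr_left (by omega))
  let x : ℕ → ℕ → ℕ := fun n j => y (Nat.pair n j)
  obtain ⟨i, hi⟩ : ∃ i, f i (x i) ≠ f 0 (x 0) := by
    by_contra! hall
    have : f 0 (x 0) ∈ ⋂ n, Set.range (f n) := Set.mem_iInter.2 fun n => ⟨x n, hall n⟩
    rw [h] at this
    exact this
  obtain ⟨U, V, hU, hV, hiU, h0V, hUV⟩ := t2_separation hi
  have key : ∀ n (W : Set α), IsOpen W → f n (x n) ∈ W →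
      ∃ N, ∀ k, N ≤ k → f n '' c k y n ⊆ W := by
    intro n W hW hnW
    obtain ⟨I, u, hu, hIu⟩ := isOpen_pi_iff.1 (hW.preimage (hf n)) (x n) hnW
    refine ⟨I.sup (Nat.pair n) + 1, fun k hk => ?_⟩
    rintro _ ⟨z, hz, rfl⟩
    refine hIu fun j hj => ?_
    have hj' : Nat.pair n j ≤ I.sup (Nat.pair n) := Finset.le_sup (f := Nat.pair n) hj
    rw [hz j (by omega)]
    exact (hu j hj).2
  obtain ⟨N, hN⟩ := key i U hU hiU
  obtain ⟨M, hM⟩ := key 0 V hV h0V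
  have hi0 : i ≠ 0 := by
    rintro rfl
    exact hi rfl
  refine hy (max N M) ⟨fun n => if n = i then U else if n = 0 then V else Set.univ,
    fun n => ?_, fun n => ?_, ?_⟩
  · dsimp only
    split_ifs
    exacts [hU.measurableSet, hV.measurableSet, MeasurableSet.univ]
  · dsimp only
    split_ifs with h1 h2
    · exact h1 ▸ hN _ (le_max_left _ _)
    · exact h2 ▸ hM _ (le_max_right _ _)
    · exact Set.subset_univ _
  · refine Set.eq_empty_of_forall_notMem fun z hz => ?_
    rw [Set.mem_iInter] at hz
    have h1 := hz i
    have h2 := hz 0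
    simp only [if_true, if_neg hi0.symm] at h1 h2
    exact Set.disjoint_left.1 hUV h1 h2

/-- **Novikov's separation theorem**: a sequence of analytic sets with empty intersection can be
enlarged to a sequence of Borel sets with empty intersection. -/
theorem jointlySeparable_of_analyticSet {α : Type*} [TopologicalSpace α] [T2Space α]
    [MeasurableSpace α] [OpensMeasurableSpace α] {s : ℕ → Set α} (hs : ∀ n, AnalyticSet (s n))
    (h : ⋂ n, s n = ∅) : JointlySeparable s := by
  by_cases hempty : ∃ i, s i = ∅
  · obtain ⟨i, hi⟩ := hempty
    refine ⟨fun n => if n = i then ∅ else Set.univ, fun n => ?_, fun n => ?_, ?_⟩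
    · dsimp only
      split_ifs
      exacts [MeasurableSet.empty, MeasurableSet.univ]
    · dsimp only
      split_ifs with hn
      exacts [(hn ▸ hi).subset, Set.subset_univ _]
    · refine Set.eq_empty_of_forall_notMem fun z hz => ?_
      simpa using Set.mem_iInter.1 hz i
  · push Not at hempty
    have : ∀ n, ∃ f : (ℕ → ℕ) → α, Continuous f ∧ Set.range f = s n := fun n => by
      have := hs n
      rw [AnalyticSet] at this
      exact this.resolve_left (hempty n).ne_empty
    choose f hf hfs using this
    simp only [← hfs] at h
    simpa only [hfs] using jointlySeparable_range hf h

end Separation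

set_option linter.unusedSectionVars false

section LocalSets

variable (G S Θ) in
/-- The measurable sets whose membership depends only on the environment and on finitely many
coordinates of the configuration. -/
def localSets : Set (Set (Θ × (G → S))) :=
  {E | MeasurableSet E ∧ ∃ A : Finset G, ∀ θ x y, (∀ a ∈ A, x a = y a) →
    ((θ, x) ∈ E ↔ (θ, y) ∈ E)}

/-- Restriction of the configuration to a finite window. -/
def restrictPat (A : Finset G) (p : Θ × (G → S)) : Θ × (A → S) := (p.1, fun a => p.2 a)

theorem measurable_restrictPat (A : Finset G) :
    Measurable (restrictPat A : Θ × (G → S) → Θ × (A → S)) := by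
  unfold restrictPat
  fun_prop

theorem restrictPat_eq_iff {A : Finset G} {p q : Θ × (G → S)} :
    restrictPat A p = restrictPat A q ↔ p.1 = q.1 ∧ ∀ a ∈ A, p.2 a = q.2 a := by
  simp [restrictPat, funext_iff]

theorem preimage_restrictPat_mem_localSets (A : Finset G) {B : Set (Θ × (A → S))}
    (hB : MeasurableSet B) : restrictPat A ⁻¹' B ∈ localSets G S Θ := by
  refine ⟨measurable_restrictPat A hB, A, fun θ x y hxy => ?_⟩
  rw [Set.mem_preimage, Set.mem_preimage,
    (restrictPat_eq_iff (p := (θ, x)) (q := (θ, y))).2 ⟨rfl, hxy⟩]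

theorem prod_univ_mem_localSets {A : Set Θ} (hA : MeasurableSet A) :
    A ×ˢ (Set.univ : Set (G → S)) ∈ localSets G S Θ :=
  ⟨hA.prod MeasurableSet.univ, ∅, by simp⟩

theorem univ_mem_localSets : (Set.univ : Set (Θ × (G → S))) ∈ localSets G S Θ :=
  ⟨MeasurableSet.univ, ∅, by simp⟩

theorem isSetRing_localSets : IsSetRing (localSets G S Θ) where
  empty_mem := ⟨MeasurableSet.empty, ∅, by simp⟩
  union_mem := by
    rintro s t ⟨hs, A, hA⟩ ⟨ht, B, hB⟩
    refine ⟨hs.union ht, A ∪ B, fun θ x y hxy => ?_⟩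
    exact or_congr (hA θ x y fun a ha => hxy a (Finset.mem_union_left _ ha))
      (hB θ x y fun a ha => hxy a (Finset.mem_union_right _ ha))
  sdiff_mem := by
    rintro s t ⟨hs, A, hA⟩ ⟨ht, B, hB⟩
    refine ⟨hs.diff ht, A ∪ B, fun θ x y hxy => ?_⟩
    exact and_congr (hA θ x y fun a ha => hxy a (Finset.mem_union_left _ ha))
      (not_congr (hB θ x y fun a ha => hxy a (Finset.mem_union_right _ ha)))

theorem generateFrom_localSets :
    (inferInstance : MeasurableSpace (Θ × (G → S))) =
      MeasurableSpace.generateFrom (localSets G S Θ) := by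
  refine le_antisymm (sup_le ?_ ?_) (MeasurableSpace.generateFrom_le fun E hE => hE.1)
  · rintro _ ⟨A, hA, rfl⟩
    rw [← Set.prod_univ]
    exact MeasurableSpace.measurableSet_generateFrom (prod_univ_mem_localSets hA)
  · rw [← measurable_iff_comap_le]
    refine @measurable_pi_lambda _ _ _ (_) _ _ fun g T hT => ?_
    refine MeasurableSpace.measurableSet_generateFrom ⟨?_, {g}, fun θ x y hxy => ?_⟩
    · exact ((measurable_pi_apply g).comp measurable_snd) hT
    · simp [hxy g (Finset.mem_singleton_self g)]

theorem isClosed_section_of_mem_localSets {E : Set (Θ × (G → S))} (hE : E ∈ localSets G S Θ)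
    (θ : Θ) : IsClosed {x | (θ, x) ∈ E} := by
  obtain ⟨-, A, hA⟩ := hE
  rw [← isOpen_compl_iff, isOpen_pi_iff]
  refine fun x hx => ⟨A, fun a => {x a}, fun a _ => ⟨isOpen_discrete _, rfl⟩, fun y hy => ?_⟩
  exact fun hyE => hx ((hA θ y x fun a ha => hy a ha).1 hyE)

theorem measurableSet_image_fst_of_mem_localSets {E : Set (Θ × (G → S))}
    (hE : E ∈ localSets G S Θ) : MeasurableSet (Prod.fst '' E) := by
  obtain ⟨hm, A, hA⟩ := hE
  have x₀ : G → S := Classical.arbitrary _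
  have : Prod.fst '' E = ⋃ u : A → S, (fun θ => (θ, mergePat A x₀ u)) ⁻¹' E := by
    ext θ
    simp only [Set.mem_image, Prod.exists, exists_and_right, exists_eq_right, Set.mem_iUnion,
      Set.mem_preimage]
    refine ⟨fun ⟨x, hx⟩ => ⟨fun a => x a, ?_⟩, fun ⟨u, hu⟩ => ⟨_, hu⟩⟩
    exact (hA θ x _ fun a ha => by simp [mergePat, ha]).1 hx
  rw [this]
  exact MeasurableSet.iUnion fun u => measurable_prodMk_right hm

theorem iInter_image_fst_eq_empty {E : ℕ → Set (Θ × (G → S))} (hE : ∀ n, E n ∈ localSets G S Θ)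
    (hanti : Antitone E) (hempty : ⋂ n, E n = ∅) : ⋂ n, Prod.fst '' E n = ∅ := by
  refine Set.eq_empty_of_forall_notMem fun θ hθ => ?_
  rw [Set.mem_iInter] at hθ
  obtain ⟨x, hx⟩ := IsCompact.nonempty_iInter_of_sequence_nonempty_isCompact_isClosed
    (fun n => {x | (θ, x) ∈ E n}) (fun n x hx => hanti n.le_succ hx)
    (fun n => by
      obtain ⟨⟨_, x⟩, hx, rfl⟩ := hθ n
      exact ⟨x, hx⟩)
    (isClosed_section_of_mem_localSets (hE 0) θ).isCompact
    (fun n => isClosed_section_of_mem_localSets (hE n) θ)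
  have : (θ, x) ∈ ⋂ n, E n := Set.mem_iInter.2 fun n => Set.mem_iInter.1 hx n
  rw [hempty] at this
  exact this

end LocalSets

section RelCont

theorem relCont_indicator (R : RelSystem G S Θ) {E : Set (Θ × (G → S))}
    (hE : E ∈ localSets G S Θ) : RelCont R (E.indicator fun _ => (1 : ℝ)) := by
  obtain ⟨hm, A, hA⟩ := hE
  refine ⟨measurable_const.indicator hm, ⟨1, fun p _ => ?_⟩, fun ε hε => ⟨A, fun θ x _ y _ h => ?_⟩⟩
  · by_cases hp : p ∈ E <;> simp [hp]
  · by_cases hy : (θ, y) ∈ E <;> simp [Set.indicator, hA θ x y h, hy, hε]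

theorem RelCont.add {f g : Θ × (G → S) → ℝ} (hf : RelCont R f) (hg : RelCont R g) :
    RelCont R (f + g) := by
  obtain ⟨hfm, ⟨c, hc⟩, hfu⟩ := hf
  obtain ⟨hgm, ⟨d, hd⟩, hgu⟩ := hg
  refine ⟨hfm.add hgm, ⟨c + d, fun p hp => ?_⟩, fun ε hε => ?_⟩
  · exact (abs_add_le _ _).trans (add_le_add (hc p hp) (hd p hp))
  · obtain ⟨A, hA⟩ := hfu (ε / 2) (half_pos hε)
    obtain ⟨B, hB⟩ := hgu (ε / 2) (half_pos hε)
    refine ⟨A ∪ B, fun θ x hx y hy hxy => ?_⟩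
    have h1 := hA θ x hx y hy fun a ha => hxy a (Finset.mem_union_left _ ha)
    have h2 := hB θ x hx y hy fun a ha => hxy a (Finset.mem_union_right _ ha)
    rw [abs_lt] at h1 h2 ⊢
    simp only [Pi.add_apply]
    constructor <;> linarith [h1.1, h1.2, h2.1, h2.2]

theorem RelCont.const_smul {f : Θ × (G → S) → ℝ} (hf : RelCont R f) (c : ℝ) :
    RelCont R (c • f) := by
  obtain ⟨hfm, ⟨d, hd⟩, hfu⟩ := hf
  refine ⟨hfm.const_smul c, ⟨|c| * d, fun p hp => ?_⟩, fun ε hε => ?_⟩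
  · simpa [abs_mul] using mul_le_mul_of_nonneg_left (hd p hp) (abs_nonneg c)
  · have hc : 0 < |c| + 1 := by positivity
    obtain ⟨A, hA⟩ := hfu (ε / (|c| + 1)) (by positivity)
    refine ⟨A, fun θ x hx y hy hxy => ?_⟩
    have h := hA θ x hx y hy hxy
    rw [lt_div_iff₀ hc] at h
    simp only [Pi.smul_apply, smul_eq_mul, ← mul_sub, abs_mul]
    nlinarith [abs_nonneg (f (θ, x) - f (θ, y))]

/-- A bounded relatively continuous observable can be brought within two thirds of its bound by
subtracting a two-valued local observable. -/
theorem RelCont.exists_localSet_abs_le [StandardBorelSpace Θ] {f : Θ × (G → S) → ℝ}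
    (hf : RelCont R f) {c : ℝ} (hc : 0 < c) (hfc : ∀ p ∈ R.Omega, |f p| ≤ c) :
    ∃ E ∈ localSets G S Θ, ∀ p ∈ R.Omega,
      |f p + (c / 3 - 2 * c / 3 * E.indicator (fun _ => (1 : ℝ)) p)| ≤ 2 * c / 3 := by
  let := upgradeStandardBorel Θ
  obtain ⟨A, hA⟩ := hf.2.2 (2 * c / 3) (by positivity)
  have hO : MeasurableSet R.Omega := R.omega_measurable
  have hP : AnalyticSet (restrictPat A '' (R.Omega ∩ {p | c / 3 ≤ f p})) :=
    (hO.inter (measurableSet_le measurable_const hf.1)).analyticSet_image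
      (measurable_restrictPat A)
  have hQ : AnalyticSet (restrictPat A '' (R.Omega ∩ {p | f p ≤ -(c / 3)})) :=
    (hO.inter (measurableSet_le hf.1 measurable_const)).analyticSet_image
      (measurable_restrictPat A)
  obtain ⟨B, hPB, hQB, hB⟩ := hP.measurablySeparable hQ (by
    rw [Set.disjoint_left]
    rintro _ ⟨⟨θ, x⟩, ⟨hx, hfx⟩, rfl⟩ ⟨⟨θ', y⟩, ⟨hy, hfy⟩, hxy⟩
    obtain ⟨h1, h2⟩ := restrictPat_eq_iff.1 hxy
    obtain rfl : θ' = θ := h1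
    have := hA θ' y hy x hx h2
    simp only [Set.mem_ofPred_eq] at hfx hfy
    rw [abs_lt] at this
    linarith [this.1])
  refine ⟨_, preimage_restrictPat_mem_localSets A hB, fun p hp => ?_⟩
  have hcp := abs_le.1 (hfc p hp)
  rw [abs_le]
  by_cases hpB : restrictPat A p ∈ B
  · have : -(c / 3) < f p := by
      by_contra! h
      exact Set.disjoint_left.1 hQB ⟨p, ⟨hp, h⟩, rfl⟩ hpB
    rw [Set.indicator_of_mem (show p ∈ restrictPat A ⁻¹' B from hpB)]
    constructor <;> linarith [hcp.1, hcp.2]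
  · have : f p < c / 3 := by
      by_contra! h
      exact hpB (hPB ⟨p, ⟨hp, h⟩, rfl⟩)
    rw [Set.indicator_of_notMem (show p ∉ restrictPat A ⁻¹' B from hpB)]
    constructor <;> linarith [hcp.1, hcp.2]

end RelCont

/-- The complement of the total space is covered by countably many local sets disjoint from the
total space. -/
theorem RelSystem.exists_localSets_cover_compl [StandardBorelSpace Θ] (R : RelSystem G S Θ) :
    ∃ E : ℕ → Set (Θ × (G → S)), (∀ n, E n ∈ localSets G S Θ) ∧
      (∀ n, Disjoint R.Omega (E n)) ∧ R.Omegaᶜ ⊆ ⋃ n, E n := by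
  let := upgradeStandardBorel Θ
  have : PolishSpace S := inferInstance
  have hO : MeasurableSet R.Omega := R.omega_measurable
  obtain ⟨e, he⟩ := exists_surjective_nat (Finset G)
  have himage : ∀ n, AnalyticSet (restrictPat (e n) '' R.Omega) := fun n =>
    hO.analyticSet_image (measurable_restrictPat _)
  have hcont : ∀ n, Continuous (restrictPat (e n) : Θ × (G → S) → Θ × (e n → S)) := fun n => by
    unfold restrictPat
    fun_prop
  obtain ⟨C, hC, hsub, hempty⟩ := jointlySeparable_of_analyticSet
    (s := fun n => R.Omegaᶜ ∩ restrictPat (e n) ⁻¹' (restrictPat (e n) '' R.Omega))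
    (fun n => by
      rw [Set.inter_eq_iInter]
      refine AnalyticSet.iInter fun b => ?_
      cases b
      · exact (himage n).preimage (hcont n)
      · exact hO.compl.analyticSet) (by
      refine Set.eq_empty_of_forall_notMem fun p hp => ?_
      rw [Set.mem_iInter] at hp
      have hpO : p.2 ∈ (R.X p.1)ᶜ := (hp 0).1
      obtain ⟨I, u, hu, hIu⟩ := isOpen_pi_iff.1 (R.X_closed p.1).isOpen_compl p.2 hpO
      obtain ⟨n, rfl⟩ := he I
      obtain ⟨q, hq, hqp⟩ := (hp n).2
      obtain ⟨h1, h2⟩ := restrictPat_eq_iff.1 hqp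
      have hqX : q.2 ∈ R.X q.1 := hq
      rw [h1] at hqX
      refine hIu (fun a ha => ?_) hqX
      rw [h2 a ha]
      exact (hu a ha).2)
  have hsep : ∀ n, MeasurablySeparable (restrictPat (e n) '' (R.Omegaᶜ \ C n))
      (restrictPat (e n) '' R.Omega) := fun n => by
    refine ((hO.compl.diff (hC n)).analyticSet_image
      (measurable_restrictPat _)).measurablySeparable (himage n) ?_
    rw [Set.disjoint_left]
    rintro _ ⟨p, ⟨hp, hpC⟩, rfl⟩ h
    exact hpC (hsub n ⟨hp, h⟩)
  choose B hBsub hBdisj hB using hsep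
  refine ⟨fun n => restrictPat (e n) ⁻¹' B n,
    fun n => preimage_restrictPat_mem_localSets _ (hB n), fun n => ?_, fun p hp => ?_⟩
  · exact Set.disjoint_left.2 fun p hp hpB =>
      Set.disjoint_left.1 (hBdisj n) (Set.mem_image_of_mem _ hp) hpB
  · obtain ⟨n, hn⟩ : ∃ n, p ∉ C n := by
      by_contra! h
      have : p ∈ ⋂ n, C n := Set.mem_iInter.2 h
      rw [hempty] at this
      exact this
    exact Set.mem_iUnion.2 ⟨n, hBsub n ⟨p, ⟨hp, hn⟩, rfl⟩⟩

/-- A positive linear functional on the bounded relatively continuous observables. -/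
structure IsPositiveLinear (R : RelSystem G S Θ) (J : (Θ × (G → S) → ℝ) → ℝ) : Prop where
  add : ∀ f g, RelCont R f → RelCont R g → J (f + g) = J f + J g
  smul : ∀ (c : ℝ) f, RelCont R f → J (c • f) = c * J f
  nonneg : ∀ f, RelCont R f → (∀ p ∈ R.Omega, 0 ≤ f p) → 0 ≤ J f

namespace IsPositiveLinear

variable {J : (Θ × (G → S) → ℝ) → ℝ}

theorem mono (hJ : IsPositiveLinear R J) {f g : Θ × (G → S) → ℝ} (hf : RelCont R f)
    (hg : RelCont R g) (hfg : ∀ p ∈ R.Omega, f p ≤ g p) : J f ≤ J g := by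
  have h := hJ.nonneg (g + (-1 : ℝ) • f) (hg.add (hf.const_smul _)) fun p hp => by
    simpa using hfg p hp
  rw [hJ.add _ _ hg (hf.const_smul _), hJ.smul _ _ hf] at h
  linarith

theorem indicator_nonneg (hJ : IsPositiveLinear R J) {E : Set (Θ × (G → S))}
    (hE : E ∈ localSets G S Θ) : 0 ≤ J (E.indicator fun _ => 1) :=
  hJ.nonneg _ (relCont_indicator R hE) fun _ _ => Set.indicator_nonneg (fun _ _ => zero_le_one) _

theorem indicator_eq_zero (hJ : IsPositiveLinear R J) {E : Set (Θ × (G → S))}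
    (hE : E ∈ localSets G S Θ) (hdisj : Disjoint R.Omega E) : J (E.indicator fun _ => 1) = 0 := by
  refine le_antisymm ?_ (hJ.indicator_nonneg hE)
  have h := hJ.mono (relCont_indicator R hE) ((relCont_indicator R hE).const_smul 0) fun p hp => by
    simp [Set.disjoint_left.1 hdisj hp]
  rwa [hJ.smul _ _ (relCont_indicator R hE), zero_mul] at h

/-- The additive content on local sets induced by a positive linear functional. -/
def content (hJ : IsPositiveLinear R J) : AddContent ℝ≥0∞ (localSets G S Θ) :=
  isSetRing_localSets.addContent_of_union
    (fun E => ENNReal.ofReal (J (E.indicator fun _ => 1)))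
    (by rw [hJ.indicator_eq_zero isSetRing_localSets.empty_mem (Set.disjoint_empty _),
      ENNReal.ofReal_zero])
    (fun {s t} hs ht hst => by
      rw [← ENNReal.ofReal_add (hJ.indicator_nonneg hs) (hJ.indicator_nonneg ht),
        ← hJ.add _ _ (relCont_indicator R hs) (relCont_indicator R ht),
        Set.indicator_union_of_disjoint hst]
      rfl)

theorem content_apply (hJ : IsPositiveLinear R J) (E : Set (Θ × (G → S))) :
    hJ.content E = ENNReal.ofReal (J (E.indicator fun _ => 1)) := rfl

theorem exists_measure (hJ : IsPositiveLinear R J) (ν : Measure Θ) [IsFiniteMeasure ν]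
    (hnorm : ∀ A : Set Θ, MeasurableSet A →
      J ((A ×ˢ (Set.univ : Set (G → S))).indicator (fun _ => (1 : ℝ))) = (ν A).toReal) :
    ∃ μ : Measure (Θ × (G → S)), ∀ E ∈ localSets G S Θ,
      μ E = ENNReal.ofReal (J (E.indicator fun _ => 1)) := by
  have htendsto : ∀ ⦃s : ℕ → Set (Θ × (G → S))⦄ (_ : ∀ n, s n ∈ localSets G S Θ),
      Antitone s → (⋂ n, s n) = ∅ → Tendsto (fun n => hJ.content (s n)) atTop (𝓝 0) := by
    intro s hs hanti hempty
    have hmeas := fun n => measurableSet_image_fst_of_mem_localSets (hs n)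
    have hν : Tendsto (fun n => ν (Prod.fst '' s n)) atTop (𝓝 0) := by
      have := tendsto_measure_iInter_atTop (μ := ν) (fun n => (hmeas n).nullMeasurableSet)
        (fun m n hmn => Set.image_mono (hanti hmn)) ⟨0, measure_ne_top _ _⟩
      rwa [iInter_image_fst_eq_empty hs hanti hempty, measure_empty] at this
    refine tendsto_of_tendsto_of_tendsto_of_le_of_le tendsto_const_nhds hν
      (fun _ => zero_le) fun n => ?_
    dsimp only
    rw [content_apply, ENNReal.ofReal_le_iff_le_toReal (measure_ne_top _ _), ← hnorm _ (hmeas n)]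
    refine hJ.mono (relCont_indicator R (hs n))
      (relCont_indicator R (prod_univ_mem_localSets (hmeas n))) fun p _ => ?_
    exact Set.indicator_le_indicator_of_subset
      (fun q hq => Set.mk_mem_prod (Set.mem_image_of_mem _ hq) (Set.mem_univ _)) (fun _ => zero_le_one) p
  have hsub : hJ.content.IsSigmaSubadditive :=
    isSigmaSubadditive_of_addContent_iUnion_eq_tsum isSetRing_localSets fun f hf hUf hd =>
      addContent_iUnion_eq_sum_of_tendsto_zero isSetRing_localSets hJ.content
        (fun s _ => ENNReal.ofReal_ne_top) htendsto hf hUf hd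
  exact ⟨hJ.content.measure isSetRing_localSets.isSetSemiring generateFrom_localSets.le hsub,
    fun E hE => hJ.content.measure_eq isSetRing_localSets.isSetSemiring generateFrom_localSets
      hsub hE⟩

variable {μ : Measure (Θ × (G → S))}

theorem measure_compl_omega_eq_zero [StandardBorelSpace Θ] (hJ : IsPositiveLinear R J)
    (hμ : ∀ E ∈ localSets G S Θ, μ E = ENNReal.ofReal (J (E.indicator fun _ => 1))) :
    μ R.Omegaᶜ = 0 := by
  obtain ⟨E, hE, hdisj, hcover⟩ := R.exists_localSets_cover_compl
  refine measure_mono_null hcover (measure_iUnion_null fun n => ?_)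
  rw [hμ _ (hE n), hJ.indicator_eq_zero (hE n) (hdisj n), ENNReal.ofReal_zero]

theorem integral_indicator_eq (hJ : IsPositiveLinear R J)
    (hμ : ∀ E ∈ localSets G S Θ, μ E = ENNReal.ofReal (J (E.indicator fun _ => 1)))
    {E : Set (Θ × (G → S))} (hE : E ∈ localSets G S Θ) :
    ∫ p, E.indicator (fun _ => (1 : ℝ)) p ∂μ = J (E.indicator fun _ => 1) := by
  rw [integral_indicator_const _ hE.1, smul_eq_mul, mul_one, measureReal_def, hμ E hE,
    ENNReal.toReal_ofReal (hJ.indicator_nonneg hE)]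

theorem abs_integral_sub_le [StandardBorelSpace Θ] [IsProbabilityMeasure μ]
    (hJ : IsPositiveLinear R J)
    (hμ : ∀ E ∈ localSets G S Θ, μ E = ENNReal.ofReal (J (E.indicator fun _ => 1)))
    (n : ℕ) {f : Θ × (G → S) → ℝ} (hf : RelCont R f) {c : ℝ} (hc : 0 < c)
    (hfc : ∀ p ∈ R.Omega, |f p| ≤ c) :
    |∫ p, f p ∂μ - J f| ≤ 2 * c * (2 / 3) ^ n := by
  have hae : ∀ᵐ p ∂μ, p ∈ R.Omega := mem_ae_iff.2 (hJ.measure_compl_omega_eq_zero hμ)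
  have hone := relCont_indicator R (univ_mem_localSets (G := G) (S := S) (Θ := Θ))
  have hJone : J (Set.univ.indicator fun _ => 1) = 1 := by
    rw [← hJ.integral_indicator_eq hμ univ_mem_localSets]
    simp
  induction n generalizing f c with
  | zero =>
    have h1 : |∫ p, f p ∂μ| ≤ c := by
      simpa using norm_integral_le_of_norm_le_const (μ := μ) (f := f) (C := c)
        (hae.mono fun p hp => hfc p hp)
    have h2 : J f ≤ c := by
      have := hJ.mono hf (hone.const_smul c) fun p hp => by
        simpa using (abs_le.1 (hfc p hp)).2
      rwa [hJ.smul _ _ hone, hJone, mul_one] at this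
    have h3 : -c ≤ J f := by
      have := hJ.mono (hone.const_smul (-c)) hf fun p hp => by
        simpa using (abs_le.1 (hfc p hp)).1
      rwa [hJ.smul _ _ hone, hJone, mul_one] at this
    rw [abs_le] at h1 ⊢
    constructor <;> linarith [h1.1, h1.2]
  | succ n ih =>
    obtain ⟨E, hE, hEc⟩ := hf.exists_localSet_abs_le hc hfc
    have hEr := relCont_indicator R hE
    have hcorr := (hone.const_smul (c / 3)).add (hEr.const_smul (-(2 * c / 3)))
    have hint : ∀ g : Θ × (G → S) → ℝ, RelCont R g → Integrable g μ := fun g hg => by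
      obtain ⟨d, hd⟩ := hg.2.1
      exact Integrable.of_bound hg.1.aestronglyMeasurable d (hae.mono fun p hp => hd p hp)
    have h := ih (hf.add hcorr) (c := 2 * c / 3) (by positivity) fun p hp => by
      have := hEc p hp
      simp only [Pi.add_apply, Pi.smul_apply, smul_eq_mul, Set.indicator_univ]
      convert this using 2
      ring
    have hintegral : ∫ p, (f + ((c / 3) • Set.univ.indicator (fun _ : Θ × (G → S) => (1 : ℝ)) +
        (-(2 * c / 3)) • E.indicator fun _ : Θ × (G → S) => (1 : ℝ)) : Θ × (G → S) → ℝ) p ∂μ =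
        ∫ p, f p ∂μ + (c / 3 * J (Set.univ.indicator fun _ => 1) +
          -(2 * c / 3) * J (E.indicator fun _ => 1)) := by
      rw [integral_add' (hint _ hf) (hint _ hcorr),
        integral_add' (hint _ (hone.const_smul _)) (hint _ (hEr.const_smul _)),
        ← hJ.integral_indicator_eq hμ univ_mem_localSets, ← hJ.integral_indicator_eq hμ hE,
        ← integral_const_mul, ← integral_const_mul]
      rfl
    rw [hintegral, hJ.add _ _ hf hcorr, hJ.add _ _ (hone.const_smul _) (hEr.const_smul _),
      hJ.smul _ _ hone, hJ.smul _ _ hEr, add_sub_add_right_eq_sub] at h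
    refine h.trans_eq ?_
    ring

theorem integral_eq [StandardBorelSpace Θ] [IsProbabilityMeasure μ] (hJ : IsPositiveLinear R J)
    (hμ : ∀ E ∈ localSets G S Θ, μ E = ENNReal.ofReal (J (E.indicator fun _ => 1)))
    {f : Θ × (G → S) → ℝ} (hf : RelCont R f) : ∫ p, f p ∂μ = J f := by
  obtain ⟨c, hc⟩ := hf.2.1
  have hbound := fun n => hJ.abs_integral_sub_le hμ n hf (c := max c 1) (by positivity)
    fun p hp => (hc p hp).trans (le_max_left _ _)
  have hlim : Tendsto (fun n : ℕ => 2 * max c 1 * (2 / 3 : ℝ) ^ n) atTop (𝓝 0) := by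
    simpa using (tendsto_pow_atTop_nhds_zero_of_lt_one (r := (2 / 3 : ℝ)) (by norm_num)
      (by norm_num)).const_mul (2 * max c 1)
  have := ge_of_tendsto' hlim hbound
  exact sub_eq_zero.1 (abs_nonpos_iff.1 this)

end IsPositiveLinear

/-- **Relative Riesz representation theorem** (Proposition A.1): if `Θ` is a standard
Borel space, then every `ν`-normalized positive linear functional on `C_Θ(Ω)` is
represented by a unique probability measure on `Ω`, whose marginal on `Θ` is `ν`. -/
theorem relative_riesz_representation
    {G : Type} [Group G] [Countable G] [DecidableEq G]
    {S : Type} [Fintype S] [Nonempty S] [TopologicalSpace S] [DiscreteTopology S]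
    [MeasurableSpace S] [MeasurableSingletonClass S]
    {Θ : Type} [MeasurableSpace Θ] [StandardBorelSpace Θ]
    (R : RelSystem G S Θ) (ν : Measure Θ) [IsProbabilityMeasure ν]
    (J : (Θ × (G → S) → ℝ) → ℝ)
    (hadd : ∀ f g : Θ × (G → S) → ℝ, RelCont R f → RelCont R g → J (f + g) = J f + J g)
    (hsmul : ∀ (c : ℝ) (f : Θ × (G → S) → ℝ), RelCont R f → J (c • f) = c * J f)
    (hwd : ∀ f g : Θ × (G → S) → ℝ, RelCont R f → RelCont R g →
      (∀ p ∈ R.Omega, f p = g p) → J f = J g)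
    (hpos : ∀ f : Θ × (G → S) → ℝ, RelCont R f → (∀ p ∈ R.Omega, 0 ≤ f p) → 0 ≤ J f)
    (hnorm : ∀ A : Set Θ, MeasurableSet A →
      J ((A ×ˢ (Set.univ : Set (G → S))).indicator (fun _ => (1:ℝ))) = (ν A).toReal) :
    ∃ μ : Measure (Θ × (G → S)), IsProbabilityMeasure μ ∧ μ R.Omega = 1 ∧
      (∀ f : Θ × (G → S) → ℝ, RelCont R f → ∫ p, f p ∂μ = J f) ∧
      μ.map Prod.fst = ν ∧
      ∀ μ' : Measure (Θ × (G → S)), IsProbabilityMeasure μ' → μ' R.Omega = 1 →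
        (∀ f : Θ × (G → S) → ℝ, RelCont R f → ∫ p, f p ∂μ' = J f) → μ' = μ := by
  have hJ : IsPositiveLinear R J := ⟨hadd, hsmul, hpos⟩
  obtain ⟨μ, hμ⟩ := hJ.exists_measure ν hnorm
  have hprob : IsProbabilityMeasure μ := ⟨by
    rw [hμ _ univ_mem_localSets, ← Set.univ_prod_univ, hnorm _ MeasurableSet.univ]
    simp⟩
  refine ⟨μ, hprob, ?_, fun f hf => hJ.integral_eq hμ hf, ?_, fun μ' hμ' _ hint => ?_⟩
  · exact (prob_compl_eq_zero_iff R.omega_measurable).1 (hJ.measure_compl_omega_eq_zero hμ)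
  · ext A hA
    rw [Measure.map_apply measurable_fst hA, ← Set.prod_univ, hμ _ (prod_univ_mem_localSets hA),
      hnorm A hA, ENNReal.ofReal_toReal (measure_ne_top _ _)]
  · refine ext_of_generate_finite (localSets G S Θ) generateFrom_localSets
      (fun s hs t ht _ => isSetRing_localSets.inter_mem hs ht) (fun E hE => ?_) (by simp)
    rw [hμ E hE, ← hint _ (relCont_indicator R hE), integral_indicator_const _ hE.1, smul_eq_mul,
      mul_one, measureReal_def, ENNReal.ofReal_toReal (measure_ne_top _ _)]

end DLR
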